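/- arXiv:0810.4946 — 8 statements merged into one kernel-verified Lean document; each statement's English description precedes it below -/
import Mathlib

section
/- Let D be a digraph, T an out-tree of D, and L a set of vertices of D containing no internal vertex of T. Let D̂ be the digraph obtained from D by deleting all arcs leaving vertices of L and all arcs not in A(T) that enter a vertex of V(T). Then the maximum number of leaves over all (T,L)-out-branchings of D equals the maximum number of leaves over all (T,L)-out-branchings of D̂ (where this maximum is defined to be 0 when no (T,L)-out-branching exists). -/
/-- `T` is an out-tree of the digraph `D` with vertex set `S`, rooted at `r`:
an oriented subtree of `D` in which every vertex of `S` is reachable from `r`,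
every vertex of `S` other than `r` has a unique in-neighbour (in-degree one),
and `r` is the unique vertex of in-degree zero. -/
structure IsOutTree {V : Type*} (D : V → V → Prop) (S : Set V) (T : V → V → Prop)
    (r : V) : Prop where
  subgraph : ∀ ⦃a b : V⦄, T a b → D a b
  mem_left : ∀ ⦃a b : V⦄, T a b → a ∈ S
  mem_right : ∀ ⦃a b : V⦄, T a b → b ∈ S
  root_mem : r ∈ S
  reach : ∀ v ∈ S, Relation.ReflTransGen T r v
  unique_pred : ∀ v ∈ S, v ≠ r → ∃! u : V, T u v
  root_no_pred : ∀ u : V, ¬ T u r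

/-- An out-branching of `D` is a spanning out-tree. -/
def IsOutBranching {V : Type*} (D T : V → V → Prop) (r : V) : Prop :=
  IsOutTree D Set.univ T r

/-- A leaf of an out-tree with arc relation `T` and vertex set `S`:
a vertex of `S` of out-degree zero. -/
def IsTreeLeaf {V : Type*} (T : V → V → Prop) (S : Set V) (v : V) : Prop :=
  v ∈ S ∧ ∀ u : V, ¬ T v u

/-- The number of leaves of an out-tree with arc relation `T` and vertex set `S`. -/
noncomputable def numLeaves {V : Type*} (T : V → V → Prop) (S : Set V) : ℕ :=
  {v | IsTreeLeaf T S v}.ncard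

/-- An internal vertex of an out-tree: a vertex of the tree that is not a leaf. -/
def IsInternal {V : Type*} (T : V → V → Prop) (S : Set V) (v : V) : Prop :=
  v ∈ S ∧ ∃ u : V, T v u

/-- A `(T,L)`-out-branching of `D` (for an out-tree `T` rooted at `r`):
an out-branching of `D` rooted at `r` whose arc set contains the arcs of `T`
and in which every vertex of `L` is a leaf. -/
def IsTLOutBranching {V : Type*} (D T : V → V → Prop) (r : V) (L : Set V)
    (T' : V → V → Prop) : Prop :=
  IsOutBranching D T' r ∧ (∀ ⦃a b : V⦄, T a b → T' a b) ∧
    ∀ v ∈ L, IsTreeLeaf T' Set.univ v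

/-- `λ(D,T,L)`: the maximum number of leaves over all `(T,L)`-out-branchings of `D`
(`0` if there is none). -/
noncomputable def maxLeafTL {V : Type*} (D T : V → V → Prop) (r : V) (L : Set V) : ℕ :=
  sSup {n | ∃ T' : V → V → Prop, IsTLOutBranching D T r L T' ∧ numLeaves T' Set.univ = n}

/-- `D̂(T,L)`: the digraph obtained from `D` by deleting all arcs leaving vertices of `L`
and all arcs not in `A(T)` that enter a vertex of `V(T) = S`. -/
def Dhat {V : Type*} (D T : V → V → Prop) (S L : Set V) : V → V → Prop :=
  fun a b => D a b ∧ a ∉ L ∧ (b ∈ S → T a b)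

theorem Dhat_le {V : Type*} {D T : V → V → Prop} {S L : Set V} ⦃a b : V⦄
    (h : Dhat D T S L a b) : D a b :=
  h.1

theorem IsOutTree.of_subgraph {V : Type*} {D D' T : V → V → Prop} {S : Set V} {r : V}
    (hT : IsOutTree D S T r) (h : ∀ ⦃a b : V⦄, T a b → D' a b) : IsOutTree D' S T r :=
  { hT with subgraph := h }

/-- An arc of an out-tree `T'` containing `T` which enters a vertex of `T` is an arc of `T`,
provided the two trees have the same root. -/
theorem IsOutTree.arc_of_mem {V : Type*} {D D' T T' : V → V → Prop} {S S' : Set V} {r a b : V}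
    (hT : IsOutTree D S T r) (hT' : IsOutTree D' S' T' r)
    (hle : ∀ ⦃a b : V⦄, T a b → T' a b) (hab : T' a b) (hb : b ∈ S) : T a b := by
  have hbr : b ≠ r := by
    rintro rfl
    exact hT'.root_no_pred a hab
  obtain ⟨u, hu, -⟩ := hT.unique_pred b hb hbr
  have hau : a = u := (hT'.unique_pred b (hT'.mem_right hab) hbr).unique hab (hle hu)
  rwa [hau]

/-- The digraphs `D` and `D̂(T,L)` have the same `(T,L)`-out-branchings. -/
theorem isTLOutBranching_Dhat_iff {V : Type*} {D T T' : V → V → Prop} {S L : Set V} {r : V}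
    (hT : IsOutTree D S T r) :
    IsTLOutBranching (Dhat D T S L) T r L T' ↔ IsTLOutBranching D T r L T' := by
  constructor
  · rintro ⟨hB, hle, hL⟩
    exact ⟨hB.of_subgraph fun _ _ h => Dhat_le (hB.subgraph h), hle, hL⟩
  · rintro ⟨hB, hle, hL⟩
    exact ⟨hB.of_subgraph fun a b h =>
      ⟨hB.subgraph h, fun ha => (hL a ha).2 b h, hT.arc_of_mem hB hle h⟩, hle, hL⟩

/-- `λ(D,T,L) = λ(D̂,T,L)`: restricting `D` to `D̂(T,L)` does not change the maximum number
of leaves over all `(T,L)`-out-branchings. -/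
theorem maxLeaf_eq_maxLeaf_Dhat
    {V : Type*} [Fintype V] (D T : V → V → Prop) (S : Set V) (r : V)
    (hT : IsOutTree D S T r) (L : Set V)
    (hL : ∀ v ∈ L, ¬ IsInternal T S v) :
    maxLeafTL D T r L = maxLeafTL (Dhat D T S L) T r L := by
  simp only [maxLeafTL, isTLOutBranching_Dhat_iff hT]
end

section
/- Let D be a digraph, T an out-tree of D, and L a set of vertices of D containing no internal vertex of T. Let D̂ be the digraph obtained from D by deleting all arcs leaving vertices of L and all arcs not in A(T) that enter a vertex of V(T). Then for every leaf x of T, λ(D,T,L) = max{ λ(D, T, L ∪ {x}), λ(D, T ∪ A⁺_D̂(x), L) }, where A⁺_D̂(x) is the set of arcs of D̂ leaving x and T ∪ A⁺_D̂(x) is the out-tree obtained from T by adding these arcs together with their heads. -/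
section

variable {V : Type*}

/-- The number of leaves of a `(T,L)`-out-branching is at most `λ(D,T,L)`. -/
theorem IsTLOutBranching.numLeaves_le_maxLeafTL [Finite V] {D T : V → V → Prop} {r : V}
    {L : Set V} {T' : V → V → Prop} (h : IsTLOutBranching D T r L T') :
    numLeaves T' Set.univ ≤ maxLeafTL D T r L := by
  refine le_csSup ⟨Nat.card V, ?_⟩ ⟨T', h, rfl⟩
  rintro n ⟨T'', -, rfl⟩
  exact Set.ncard_le_card _

/-- A bound on the number of leaves of every `(T,L)`-out-branching bounds `λ(D,T,L)`. -/
theorem maxLeafTL_le {D T : V → V → Prop} {r : V} {L : Set V} {m : ℕ}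
    (h : ∀ T', IsTLOutBranching D T r L T' → numLeaves T' Set.univ ≤ m) :
    maxLeafTL D T r L ≤ m := by
  apply csSup_le'
  rintro n ⟨T', hT', rfl⟩
  exact h T' hT'

/-- `λ(D,T,L)` is antitone in the required arcs and in the required leaves. -/
theorem maxLeafTL_anti [Finite V] {D T₁ T₂ : V → V → Prop} {r : V} {L₁ L₂ : Set V}
    (hT : ∀ ⦃a b⦄, T₁ a b → T₂ a b) (hL : L₁ ⊆ L₂) :
    maxLeafTL D T₂ r L₂ ≤ maxLeafTL D T₁ r L₁ :=
  maxLeafTL_le fun _ h => IsTLOutBranching.numLeaves_le_maxLeafTL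
    ⟨h.1, fun _ _ hab => h.2.1 (hT hab), fun v hv => h.2.2 v (hL hv)⟩

/-- Replace all arcs of `T` entering `A` by the arcs from `x` to the vertices of `A`. -/
def redirect (T : V → V → Prop) (x : V) (A : Set V) : V → V → Prop :=
  fun a b => (b ∉ A ∧ T a b) ∨ (a = x ∧ b ∈ A)

/-- Redirecting to a vertex `x` arcs of an out-branching that enter out-neighbours of `x` yields an
out-branching, provided that `x` is reachable from the root without the redirected arcs. -/
theorem IsOutBranching.redirect {D T : V → V → Prop} {r x : V} {A : Set V}
    (h : IsOutBranching D T r) (hA : ∀ b ∈ A, D x b) (hr : r ∉ A)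
    (hx : Relation.ReflTransGen (redirect T x A) r x) :
    IsOutBranching D (redirect T x A) r where
  subgraph := by
    rintro a b (⟨-, hab⟩ | ⟨rfl, hb⟩)
    exacts [h.subgraph hab, hA b hb]
  mem_left _ _ _ := Set.mem_univ _
  mem_right _ _ _ := Set.mem_univ _
  root_mem := Set.mem_univ _
  reach v _ := by
    induction h.reach v (Set.mem_univ v) with
    | refl => exact .refl
    | @tail a b _ hab ih =>
      by_cases hb : b ∈ A
      · exact hx.tail (Or.inr ⟨rfl, hb⟩)
      · exact (ih (Set.mem_univ a)).tail (Or.inl ⟨hb, hab⟩)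
  unique_pred v _ hv := by
    by_cases hvA : v ∈ A
    · refine ⟨x, Or.inr ⟨rfl, hvA⟩, ?_⟩
      rintro y (⟨hn, -⟩ | ⟨rfl, -⟩)
      exacts [absurd hvA hn, rfl]
    · obtain ⟨u, hu, huniq⟩ := h.unique_pred v (Set.mem_univ v) hv
      refine ⟨u, Or.inl ⟨hvA, hu⟩, ?_⟩
      rintro y (⟨-, hy⟩ | ⟨-, hn⟩)
      exacts [huniq y hy, absurd hn hvA]
  root_no_pred u := by
    rintro (⟨-, hu⟩ | ⟨-, hn⟩)
    exacts [h.root_no_pred u hu, hr hn]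

/-- Redirecting arcs to a vertex that is not a leaf preserves all leaves. -/
theorem IsTreeLeaf.redirect {T : V → V → Prop} {S A : Set V} {x v : V}
    (hv : IsTreeLeaf T S v) (hx : ∃ u, T x u) : IsTreeLeaf (redirect T x A) S v := by
  refine ⟨hv.1, ?_⟩
  rintro u (⟨-, hu⟩ | ⟨rfl, -⟩)
  · exact hv.2 u hu
  · exact hx.elim hv.2

/-- If a leaf `x` of `T` is internal in a `(T,L)`-out-branching `T'`, then some
`(T ∪ A⁺_{D̂}(x), L)`-out-branching has at least as many leaves as `T'`. -/
theorem IsTLOutBranching.exists_extend [Finite V] {D T T' : V → V → Prop} {S L : Set V} {r x : V}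
    (hT : IsOutTree D S T r) (hx : IsTreeLeaf T S x) (h : IsTLOutBranching D T r L T')
    (hxT' : ∃ u, T' x u) :
    ∃ T'', IsTLOutBranching D (fun a b => T a b ∨ (a = x ∧ Dhat D T S L a b)) r L T'' ∧
      numLeaves T' Set.univ ≤ numLeaves T'' Set.univ := by
  have hA : ∀ b ∈ S, b ∉ {b | Dhat D T S L x b} := fun b hb hxb => hx.2 b (hxb.2.2 hb)
  have hsub : ∀ a b, T a b → redirect T' x {b | Dhat D T S L x b} a b :=
    fun a b hab => Or.inl ⟨hA b (hT.mem_right hab), h.2.1 hab⟩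
  refine ⟨redirect T' x {b | Dhat D T S L x b}, ⟨?_, ?_, ?_⟩, ?_⟩
  · exact h.1.redirect (fun b hb => hb.1) (hA r hT.root_mem)
      (Relation.ReflTransGen.mono hsub _ _ (hT.reach x hx.1))
  · rintro a b (hab | ⟨rfl, hab⟩)
    exacts [hsub a b hab, Or.inr ⟨rfl, hab⟩]
  · exact fun v hv => (h.2.2 v hv).redirect hxT'
  · exact Set.ncard_le_ncard fun v hv => IsTreeLeaf.redirect hv hxT'

end

/-- For every leaf `x` of `T`,
`λ(D,T,L) = max { λ(D,T,L ∪ {x}), λ(D, T ∪ A⁺_{D̂}(x), L) }`. -/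
theorem maxLeaf_branching_rule
    {V : Type*} [Fintype V] (D T : V → V → Prop) (S : Set V) (r : V)
    (hT : IsOutTree D S T r) (L : Set V)
    (hL : ∀ v ∈ L, ¬ IsInternal T S v)
    (x : V) (hx : IsTreeLeaf T S x) :
    maxLeafTL D T r L =
      max (maxLeafTL D T r (L ∪ {x}))
        (maxLeafTL D (fun a b => T a b ∨ (a = x ∧ Dhat D T S L a b)) r L) := by
  apply le_antisymm
  · refine maxLeafTL_le fun T' h => ?_
    by_cases hxT' : ∃ u, T' x u
    · obtain ⟨T'', h'', hle⟩ := h.exists_extend hT hx hxT'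
      exact le_max_of_le_right (hle.trans h''.numLeaves_le_maxLeafTL)
    · refine le_max_of_le_left (IsTLOutBranching.numLeaves_le_maxLeafTL ⟨h.1, h.2.1, ?_⟩)
      rintro v (hv | rfl)
      exacts [h.2.2 v hv, ⟨Set.mem_univ _, not_exists.mp hxT'⟩]
  · exact max_le (maxLeafTL_anti (fun _ _ => id) Set.subset_union_left)
      (maxLeafTL_anti (fun _ _ => Or.inl) subset_rfl)
end

section
/- Let D be a digraph and let u and v be two distinct vertices such that every vertex of D is reachable by a directed path from u or from v. Then there exist two vertex-disjoint out-trees T_u and T_v of D, rooted at u and v respectively, with V(T_u) ∪ V(T_v) = V(D). -/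
/-- If every vertex is reachable from the root set `Q`, then every vertex outside `Q` can be
given a parent in such a way that passing to the parent decreases a rank function. -/
theorem exists_parent_rank {V : Type*} (D : V → V → Prop) (Q : Set V)
    (h : ∀ w, ∃ r ∈ Q, Relation.ReflTransGen D r w) :
    ∃ (p : V → V) (d : V → ℕ), ∀ w ∉ Q, D (p w) w ∧ d (p w) < d w := by
  classical
  let R : ℕ → V → Prop := Nat.rec (motive := fun _ => V → Prop) (· ∈ Q) (fun _ P w => ∃ a, P a ∧ D a w)
  have hR : ∀ w, ∃ n, R n w := by
    intro w
    obtain ⟨r, hr, hw⟩ := h w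
    induction hw with
    | refl => exact ⟨0, hr⟩
    | tail _ hbc ih =>
      obtain ⟨n, hn⟩ := ih
      exact ⟨n + 1, _, hn, hbc⟩
  have hparent : ∀ w : V, ∃ a : V, w ∉ Q → D a w ∧ Nat.find (hR a) < Nat.find (hR w) := by
    intro w
    by_cases hw : w ∈ Q
    · exact ⟨w, fun h => absurd hw h⟩
    have hs := Nat.find_spec (hR w)
    rcases hn : Nat.find (hR w) with _ | n
    · rw [hn] at hs
      exact absurd hs hw
    · rw [hn] at hs
      obtain ⟨a, ha, haw⟩ := hs
      exact ⟨a, fun _ => ⟨haw, Nat.lt_succ_of_le (Nat.find_min' (hR a) ha)⟩⟩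
  choose p hp using hparent
  exact ⟨p, fun w => Nat.find (hR w), hp⟩

/-- The arcs from parents to children, for vertices outside the root set `Q`. -/
def ParentArc {V : Type*} (Q : Set V) (p : V → V) (a b : V) : Prop :=
  b ∉ Q ∧ a = p b

/-- The vertices descending from a root form an out-tree. -/
theorem isOutTree_parentArc {V : Type*} {D : V → V → Prop} {Q : Set V} {p : V → V}
    (hp : ∀ w ∉ Q, D (p w) w) {r : V} (hr : r ∈ Q) :
    IsOutTree D {w | Relation.ReflTransGen (ParentArc Q p) r w}
      (fun a b => ParentArc Q p a b ∧ Relation.ReflTransGen (ParentArc Q p) r a) r where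
  subgraph := by
    rintro a b ⟨⟨hb, rfl⟩, -⟩
    exact hp b hb
  mem_left := fun _ _ h => h.2
  mem_right := fun _ _ h => h.2.tail h.1
  root_mem := .refl
  reach := by
    intro w hw
    induction hw with
    | refl => exact .refl
    | tail hb hbc ih => exact ih.tail ⟨hbc, hb⟩
  unique_pred := by
    intro w hw hne
    rcases Relation.ReflTransGen.cases_tail hw with rfl | ⟨a, ha, haw⟩
    · exact absurd rfl hne
    · exact ⟨a, ⟨haw, ha⟩, fun b hb => hb.1.2.trans haw.2.symm⟩
  root_no_pred := fun _ h => h.1.1 hr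

/-- A vertex descends from at most one root. -/
theorem root_unique_of_parentArc {V : Type*} {Q : Set V} {p : V → V} {r s w : V}
    (hr : r ∈ Q) (hs : s ∈ Q) (hrw : Relation.ReflTransGen (ParentArc Q p) r w)
    (hsw : Relation.ReflTransGen (ParentArc Q p) s w) : r = s := by
  induction hrw with
  | refl =>
    rcases Relation.ReflTransGen.cases_tail hsw with h | ⟨_, _, h⟩
    · exact h
    · exact absurd hr h.1
  | tail _ hbc ih =>
    rcases Relation.ReflTransGen.cases_tail hsw with rfl | ⟨a, ha, h⟩
    · exact absurd hs hbc.1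
    · obtain rfl : a = _ := h.2.trans hbc.2.symm
      exact ih ha

/-- If parents have smaller rank, then every vertex descends from some root. -/
theorem exists_root_of_parentArc {V : Type*} {Q : Set V} {p : V → V} {d : V → ℕ}
    (hd : ∀ w ∉ Q, d (p w) < d w) (w : V) :
    ∃ r ∈ Q, Relation.ReflTransGen (ParentArc Q p) r w := by
  induction hn : d w using Nat.strong_induction_on generalizing w with
  | _ n ih =>
    by_cases hw : w ∈ Q
    · exact ⟨w, hw, .refl⟩
    · obtain ⟨r, hr, hrw⟩ := ih _ (hn ▸ hd w hw) (p w) rfl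
      exact ⟨r, hr, hrw.tail ⟨hw, rfl⟩⟩

/-- If every vertex of `D` is reachable from `u` or from `v` (`u ≠ v`), then there are two
vertex-disjoint out-trees rooted at `u` and `v` whose vertex sets cover `V(D)`. -/
theorem exists_two_disjoint_spanning_out_trees
    {V : Type*} [Fintype V] (D : V → V → Prop) (u v : V) (huv : u ≠ v)
    (hreach : ∀ w : V, Relation.ReflTransGen D u w ∨ Relation.ReflTransGen D v w) :
    ∃ (Su Sv : Set V) (Tu Tv : V → V → Prop),
      IsOutTree D Su Tu u ∧ IsOutTree D Sv Tv v ∧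
      Disjoint Su Sv ∧ Su ∪ Sv = Set.univ := by
  obtain ⟨p, d, hpd⟩ := exists_parent_rank D {u, v} (by simpa using hreach)
  have hu : u ∈ ({u, v} : Set V) := by simp
  have hv : v ∈ ({u, v} : Set V) := by simp
  refine ⟨_, _, _, _, isOutTree_parentArc (fun w hw => (hpd w hw).1) hu,
    isOutTree_parentArc (fun w hw => (hpd w hw).1) hv, ?_, ?_⟩
  · rw [Set.disjoint_left]
    exact fun w hwu hwv => huv (root_unique_of_parentArc hu hv hwu hwv)
  · rw [Set.eq_univ_iff_forall]
    intro w
    obtain ⟨r, rfl | rfl, hrw⟩ := exists_root_of_parentArc (fun w hw => (hpd w hw).2) w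
    · exact Or.inl hrw
    · exact Or.inr hrw
end

section
/- Let D be an acyclic digraph with exactly one vertex s of in-degree zero, and let xy be an arc of D with out-degree of x equal to 1 and in-degree of y equal to 1. Let D' be the digraph obtained from D by contracting the arc xy. Then, for every k, D' has an out-branching with at least k leaves if and only if D has an out-branching with at least k leaves. -/
/-- The digraph on `V ∖ {y}` obtained by contracting the arc `x → y` into the vertex `x`. -/
def contractArc {V : Type*} (D : V → V → Prop) (x y : V) : V → V → Prop :=
  fun a b => a ≠ y ∧ b ≠ y ∧ (D a b ∨ (a = x ∧ D y b))

/-- The tree obtained by reinserting `y` below `x`, moving the children of `x` to `y`. -/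
def expandTree {V : Type*} (T : V → V → Prop) (x y : V) : V → V → Prop :=
  fun a b => (a ≠ x ∧ T a b) ∨ (a = x ∧ b = y) ∨ (a = y ∧ T x b)

/-- The tree obtained by deleting `y` and moving its children to `x`. -/
def contractTree {V : Type*} (T : V → V → Prop) (x y : V) : V → V → Prop :=
  fun a b => b ≠ y ∧ ((a ≠ y ∧ a ≠ x ∧ T a b) ∨ (a = x ∧ T y b))

theorem IsOutTree.expandTree {V : Type*} {D T : V → V → Prop} {x y r : V} (hne : x ≠ y)
    (hxy : D x y) (hdx : ∀ b : V, D x b → b = y)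
    (h : IsOutTree (contractArc D x y) {w | w ≠ y} T r) :
    IsOutBranching D (expandTree T x y) r := by
  have hr : ∀ {a b}, T a b → b ≠ y := fun hab => h.mem_right hab
  have hry : r ≠ y := h.root_mem
  have hreach : ∀ v, Relation.ReflTransGen T r v →
      Relation.ReflTransGen (_root_.expandTree T x y) r v := by
    intro v hv
    induction hv with
    | refl => exact .refl
    | @tail b c _ hbc ih =>
      by_cases hb : b = x
      · subst hb
        exact (ih.tail (Or.inr (Or.inl ⟨rfl, rfl⟩))).tail (Or.inr (Or.inr ⟨rfl, hbc⟩))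
      · exact ih.tail (Or.inl ⟨hb, hbc⟩)
  refine ⟨?_, fun _ _ _ => trivial, fun _ _ _ => trivial, trivial, ?_, ?_, ?_⟩
  · rintro a b (⟨ha, hab⟩ | ⟨rfl, rfl⟩ | ⟨rfl, hab⟩)
    · rcases (h.subgraph hab).2.2 with hD | hD
      · exact hD
      · exact absurd hD.1 ha
    · exact hxy
    · rcases (h.subgraph hab).2.2 with hD | hD
      · exact absurd (hdx b hD) (hr hab)
      · exact hD.2
  · intro v _
    by_cases hv : v = y
    · subst hv
      exact (hreach x (h.reach x hne)).tail (Or.inr (Or.inl ⟨rfl, rfl⟩))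
    · exact hreach v (h.reach v hv)
  · intro v _ hvr
    by_cases hv : v = y
    · subst hv
      refine ⟨x, Or.inr (Or.inl ⟨rfl, rfl⟩), ?_⟩
      rintro a (⟨_, ha⟩ | ⟨ha, _⟩ | ⟨_, ha⟩)
      · exact absurd rfl (hr ha)
      · exact ha
      · exact absurd rfl (hr ha)
    · obtain ⟨u, hu, huu⟩ := h.unique_pred v hv hvr
      by_cases hux : u = x
      · subst hux
        refine ⟨y, Or.inr (Or.inr ⟨rfl, hu⟩), ?_⟩
        rintro a (⟨hax, ha⟩ | ⟨_, ha⟩ | ⟨ha, _⟩)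
        · exact absurd (huu a ha) hax
        · exact absurd ha hv
        · exact ha
      · refine ⟨u, Or.inl ⟨hux, hu⟩, ?_⟩
        rintro a (⟨_, ha⟩ | ⟨_, ha⟩ | ⟨_, ha⟩)
        · exact huu a ha
        · exact absurd ha hv
        · exact absurd (huu x ha).symm hux
  · rintro u (⟨_, hu⟩ | ⟨_, hu⟩ | ⟨_, hu⟩)
    · exact h.root_no_pred u hu
    · exact hry hu
    · exact h.root_no_pred x hu

theorem numLeaves_le_numLeaves_expandTree {V : Type*} [Finite V] {T : V → V → Prop} {x y : V}
    (hl : ∀ ⦃a b⦄, T a b → a ≠ y) :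
    numLeaves T {w | w ≠ y} ≤ numLeaves (expandTree T x y) Set.univ := by
  classical
  refine Set.ncard_le_ncard_of_injOn (fun v => if v = x then y else v) ?_ ?_ (Set.toFinite _)
  · rintro v ⟨hvy, hv⟩
    have hvy : v ≠ y := hvy
    refine ⟨trivial, ?_⟩
    split_ifs with hvx
    · subst hvx
      rintro u (⟨_, hu⟩ | ⟨hu, _⟩ | ⟨_, hu⟩)
      · exact hl hu rfl
      · exact hvy hu.symm
      · exact hv u hu
    · rintro u (⟨_, hu⟩ | ⟨hu, _⟩ | ⟨hu, _⟩)
      · exact hv u hu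
      · exact hvx hu
      · exact hvy hu
  · rintro a ⟨ha, _⟩ b ⟨hb, _⟩ hab
    have ha : a ≠ y := ha
    have hb : b ≠ y := hb
    dsimp only at hab
    split_ifs at hab <;> simp_all

theorem IsOutBranching.contractTree {V : Type*} {D T : V → V → Prop} {x y r : V} (hne : x ≠ y)
    (hyy : ¬ D y y) (hry : r ≠ y) (hdx : ∀ b : V, D x b → b = y) (hdy : ∀ a : V, D a y → a = x)
    (h : IsOutBranching D T r) :
    IsOutTree (contractArc D x y) {w | w ≠ y} (contractTree T x y) r := by
  classical
  have hreach : ∀ v, Relation.ReflTransGen T r v →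
      Relation.ReflTransGen (_root_.contractTree T x y) r (if v = y then x else v) := by
    intro v hv
    induction hv with
    | refl => rw [if_neg hry]
    | @tail b c _ hbc ih =>
      by_cases hc : c = y
      · subst hc
        have hb := hdy b (h.subgraph hbc)
        subst hb
        rw [if_neg hne] at ih
        rwa [if_pos rfl]
      · rw [if_neg hc]
        refine ih.tail ⟨hc, ?_⟩
        split_ifs with hb
        · subst hb
          exact Or.inr ⟨rfl, hbc⟩
        · refine Or.inl ⟨hb, ?_, hbc⟩
          rintro rfl
          exact hc (hdx c (h.subgraph hbc))
  refine ⟨?_, ?_, fun _ _ hab => hab.1, hry, ?_, ?_, ?_⟩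
  · rintro a b ⟨hb, ⟨ha, _, hab⟩ | ⟨rfl, hab⟩⟩
    · exact ⟨ha, hb, Or.inl (h.subgraph hab)⟩
    · exact ⟨hne, hb, Or.inr ⟨rfl, h.subgraph hab⟩⟩
  · rintro a b ⟨_, ⟨ha, _⟩ | ⟨rfl, _⟩⟩
    · exact ha
    · exact hne
  · intro v hv
    simpa only [if_neg (show ¬ v = y from hv)] using hreach v (h.reach v trivial)
  · intro v hv hvr
    have hv : v ≠ y := hv
    obtain ⟨u, hu, huu⟩ := h.unique_pred v trivial hvr
    by_cases huy : u = y
    · subst huy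
      refine ⟨x, ⟨hv, Or.inr ⟨rfl, hu⟩⟩, ?_⟩
      rintro a ⟨_, ⟨hay, _, ha⟩ | ⟨ha, _⟩⟩
      · exact absurd (huu a ha) hay
      · exact ha
    · have hux : u ≠ x := by
        rintro rfl
        exact hv (hdx v (h.subgraph hu))
      refine ⟨u, ⟨hv, Or.inl ⟨huy, hux, hu⟩⟩, ?_⟩
      rintro a ⟨_, ⟨_, _, ha⟩ | ⟨_, ha⟩⟩
      · exact huu a ha
      · exact absurd (huu y ha).symm huy
  · rintro u ⟨_, ⟨_, _, hu⟩ | ⟨_, hu⟩⟩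
    · exact h.root_no_pred u hu
    · exact h.root_no_pred y hu

theorem numLeaves_le_numLeaves_contractTree {V : Type*} [Finite V] {T : V → V → Prop} {x y : V}
    (hne : x ≠ y) (hT : T x y) :
    numLeaves T Set.univ ≤ numLeaves (contractTree T x y) {w | w ≠ y} := by
  classical
  have hleaf : ∀ {v}, IsTreeLeaf T Set.univ v → v ≠ x := by
    rintro v ⟨_, hv⟩ rfl
    exact hv y hT
  refine Set.ncard_le_ncard_of_injOn (fun v => if v = y then x else v) ?_ ?_ (Set.toFinite _)
  · intro v hv
    have hvx := hleaf hv
    split_ifs with hvy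
    · subst hvy
      refine ⟨hne, ?_⟩
      rintro u ⟨_, ⟨_, hu, _⟩ | ⟨_, hu⟩⟩
      · exact hu rfl
      · exact hv.2 u hu
    · refine ⟨hvy, ?_⟩
      rintro u ⟨_, ⟨_, _, hu⟩ | ⟨hu, _⟩⟩
      · exact hv.2 u hu
      · exact hvx hu
  · intro a ha b hb hab
    have ha := hleaf ha
    have hb := hleaf hb
    dsimp only at hab
    split_ifs at hab <;> simp_all

/-- Reduction Rule A: contracting an arc `x → y` with `d⁺(x) = d⁻(y) = 1` in an acyclic
digraph with a single source `s` preserves, for every `k`, the existence of an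
out-branching with at least `k` leaves. Here the contracted digraph `D'` is realised on
the vertex set `V ∖ {y}`, the contracted vertex being `x`. -/
theorem contraction_preserves_k_out_branching
    {V : Type*} [Fintype V] (D : V → V → Prop)
    (hacyc : ∀ w : V, ¬ Relation.TransGen D w w)
    (s : V) (hs : ∀ u : V, ¬ D u s) (huniq : ∀ w : V, (∀ u : V, ¬ D u w) → w = s)
    (x y : V) (hxy : D x y)
    (hdx : ∀ b : V, D x b → b = y)
    (hdy : ∀ a : V, D a y → a = x)
    (k : ℕ) :
    (∃ (r : V) (T' : V → V → Prop),
        IsOutTree (fun a b => a ≠ y ∧ b ≠ y ∧ (D a b ∨ (a = x ∧ D y b)))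
          {w : V | w ≠ y} T' r ∧ k ≤ numLeaves T' {w : V | w ≠ y}) ↔
    (∃ (r : V) (T : V → V → Prop), IsOutBranching D T r ∧ k ≤ numLeaves T Set.univ) := by
  have hyy : ¬ D y y := fun h => hacyc y (.single h)
  have hne : x ≠ y := by
    rintro rfl
    exact hyy hxy
  constructor
  · rintro ⟨r, T, hT, hk⟩
    exact ⟨r, expandTree T x y, IsOutTree.expandTree hne hxy hdx hT,
      hk.trans (numLeaves_le_numLeaves_expandTree hT.mem_left)⟩
  · rintro ⟨r, T, hT, hk⟩
    have hry : r ≠ y := by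
      rintro rfl
      have hrx := Relation.ReflTransGen.mono hT.subgraph _ _ (hT.reach x trivial)
      exact hacyc r (.tail' hrx hxy)
    obtain ⟨u, hu, -⟩ := hT.unique_pred y trivial hry.symm
    have hux := hdy u (hT.subgraph hu)
    subst hux
    exact ⟨r, contractTree T u y, hT.contractTree hne hyy hry hdx hdy,
      hk.trans (numLeaves_le_numLeaves_contractTree hne hu)⟩
end

section
/- Let D be an acyclic digraph with exactly one vertex s of in-degree zero, and let xy be an arc of D with out-degree of x at least 2, in-degree of y equal to 1, and x ≠ s. Let D' be the digraph obtained from D by deleting x and adding an arc uv for every in-neighbor u of x and every out-neighbor v of x. Then, for every k, D' has an out-branching with at least k leaves if and only if D has an out-branching with at least k leaves. -/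
/-- In a digraph whose arcs increase a well-founded relation, choosing a unique in-neighbour for
every vertex of `S` but `r` yields an out-tree rooted at `r`. -/
theorem IsOutTree.of_wellFounded {V : Type*} {D R T : V → V → Prop} {S : Set V} {r : V}
    (hR : WellFounded R) (hDR : ∀ ⦃a b : V⦄, D a b → R a b)
    (subgraph : ∀ ⦃a b : V⦄, T a b → D a b)
    (mem_left : ∀ ⦃a b : V⦄, T a b → a ∈ S) (mem_right : ∀ ⦃a b : V⦄, T a b → b ∈ S)
    (root_mem : r ∈ S) (unique_pred : ∀ v ∈ S, v ≠ r → ∃! u : V, T u v)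
    (root_no_pred : ∀ u : V, ¬ T u r) : IsOutTree D S T r where
  subgraph := subgraph
  mem_left := mem_left
  mem_right := mem_right
  root_mem := root_mem
  unique_pred := unique_pred
  root_no_pred := root_no_pred
  reach v := by
    induction v using hR.induction with
    | _ v ih =>
      intro hv
      by_cases h : v = r
      · exact h ▸ .refl
      · obtain ⟨u, hu, -⟩ := unique_pred v hv h
        exact (ih u (hDR (subgraph hu)) (mem_left hu)).tail hu

/-- A vertex of an out-tree without in-neighbours in the digraph is the root. -/
theorem IsOutTree.eq_root {V : Type*} {D T : V → V → Prop} {S : Set V} {r s : V}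
    (h : IsOutTree D S T r) (hsS : s ∈ S) (hs : ∀ u : V, ¬ D u s) : s = r := by
  by_contra hne
  obtain ⟨u, hu, -⟩ := h.unique_pred s hsS hne
  exact hs u (h.subgraph hu)

theorem numLeaves_le_of_isTreeLeaf_imp {V : Type*} [Finite V] {T₁ T₂ : V → V → Prop}
    {S₁ S₂ : Set V} (h : ∀ v, IsTreeLeaf T₁ S₁ v → IsTreeLeaf T₂ S₂ v) :
    numLeaves T₁ S₁ ≤ numLeaves T₂ S₂ :=
  Set.ncard_le_ncard h (Set.toFinite _)

/-- Reduction Rule B: if `x → y` is an arc with `d⁺(x) ≥ 2`, `d⁻(y) = 1` and `x ≠ s` in an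
acyclic digraph with a single source `s`, then deleting `x` and adding an arc `u → v` for
every in-neighbour `u` of `x` and every out-neighbour `v` of `x` preserves, for every `k`,
the existence of an out-branching with at least `k` leaves. The reduced digraph `D'` is
realised on the vertex set `V ∖ {x}`. -/
theorem ruleB_preserves_k_out_branching
    {V : Type*} [Fintype V] (D : V → V → Prop)
    (hacyc : ∀ w : V, ¬ Relation.TransGen D w w)
    (s : V) (hs : ∀ u : V, ¬ D u s) (huniq : ∀ w : V, (∀ u : V, ¬ D u w) → w = s)
    (x y : V) (hxy : D x y)
    (hdx : 2 ≤ {b : V | D x b}.ncard)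
    (hdy : ∀ a : V, D a y → a = x)
    (hxs : x ≠ s)
    (k : ℕ) :
    (∃ (r : V) (T' : V → V → Prop),
        IsOutTree (fun a b => a ≠ x ∧ b ≠ x ∧ (D a b ∨ (D a x ∧ D x b)))
          {w : V | w ≠ x} T' r ∧ k ≤ numLeaves T' {w : V | w ≠ x}) ↔
    (∃ (r : V) (T : V → V → Prop), IsOutBranching D T r ∧ k ≤ numLeaves T Set.univ) := by
  have hwf : WellFounded (Relation.TransGen D) := by
    have : Std.Irrefl (Relation.TransGen D) := ⟨hacyc⟩
    exact Finite.wellFounded_of_trans_of_irrefl _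
  have hxx : ¬ D x x := fun h => hacyc x (.single h)
  have hyx : y ≠ x := by rintro rfl; exact hxx hxy
  have hys : y ≠ s := by rintro rfl; exact hs x hxy
  constructor
  · rintro ⟨r, T', hT', hk⟩
    obtain rfl : s = r := hT'.eq_root (Ne.symm hxs) fun u hu =>
      hu.2.2.elim (hs u) fun h => hs x h.2
    refine ⟨s, fun a b => (a = x ∧ D x b) ∨ (b = x ∧ T' a y) ∨ (¬ D x b ∧ T' a b), ?_, ?_⟩
    · refine IsOutTree.of_wellFounded hwf (fun _ _ => .single) ?_ (fun _ _ _ => trivial)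
        (fun _ _ _ => trivial) trivial ?_ ?_
      · rintro a b (⟨rfl, h⟩ | ⟨rfl, h⟩ | ⟨hn, h⟩)
        · exact h
        · obtain ⟨hax, -, h | h⟩ := hT'.subgraph h
          · exact absurd (hdy a h) hax
          · exact h.1
        · obtain ⟨-, -, h | h⟩ := hT'.subgraph h
          · exact h
          · exact absurd h.2 hn
      · intro v _ hv
        by_cases hvx : v = x
        · subst hvx
          obtain ⟨u, hu, huu⟩ := hT'.unique_pred y hyx hys
          refine ⟨u, .inr (.inl ⟨rfl, hu⟩), ?_⟩
          rintro w (⟨-, h⟩ | ⟨-, h⟩ | ⟨-, h⟩)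
          · exact absurd h hxx
          · exact huu w h
          · exact absurd rfl (hT'.mem_right h)
        · by_cases hxv : D x v
          · refine ⟨x, .inl ⟨rfl, hxv⟩, ?_⟩
            rintro w (⟨h, -⟩ | ⟨h, -⟩ | ⟨h, -⟩)
            · exact h
            · exact absurd h hvx
            · exact absurd hxv h
          · obtain ⟨u, hu, huu⟩ := hT'.unique_pred v hvx hv
            refine ⟨u, .inr (.inr ⟨hxv, hu⟩), ?_⟩
            rintro w (⟨-, h⟩ | ⟨h, -⟩ | ⟨-, h⟩)
            · exact absurd h hxv
            · exact absurd h hvx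
            · exact huu w h
      · rintro u (⟨-, h⟩ | ⟨h, -⟩ | ⟨-, h⟩)
        · exact hs x h
        · exact hxs h.symm
        · exact hT'.root_no_pred u h
    · refine hk.trans (numLeaves_le_of_isTreeLeaf_imp ?_)
      rintro v ⟨hvx, hv⟩
      refine ⟨trivial, ?_⟩
      rintro u (⟨h, -⟩ | ⟨-, h⟩ | ⟨-, h⟩)
      · exact hvx h
      · exact hv y h
      · exact hv u h
  · rintro ⟨r, T, hT, hk⟩
    obtain rfl : s = r := hT.eq_root trivial hs
    obtain ⟨p, hp, hpu⟩ := hT.unique_pred x trivial hxs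
    have hpx : p ≠ x := by rintro rfl; exact hxx (hT.subgraph hp)
    refine ⟨s, fun a b => a ≠ x ∧ b ≠ x ∧ (T a b ∨ (T a x ∧ T x b)), ?_, ?_⟩
    · refine IsOutTree.of_wellFounded hwf ?_ ?_ (fun _ _ h => h.1) (fun _ _ h => h.2.1)
        (Ne.symm hxs) ?_ ?_
      · rintro a b ⟨-, -, h | h⟩
        · exact .single h
        · exact .tail (.single h.1) h.2
      · rintro a b ⟨ha, hb, h⟩
        exact ⟨ha, hb, h.imp (@hT.subgraph _ _) (.imp (@hT.subgraph _ _) (@hT.subgraph _ _))⟩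
      · intro v hvx hv
        obtain ⟨u, hu, huu⟩ := hT.unique_pred v trivial hv
        by_cases hux : u = x
        · subst hux
          refine ⟨p, ⟨hpx, hvx, .inr ⟨hp, hu⟩⟩, ?_⟩
          rintro w ⟨hw, -, h | h⟩
          · exact absurd (huu w h) hw
          · exact hpu w h.1
        · refine ⟨u, ⟨hux, hvx, .inl hu⟩, ?_⟩
          rintro w ⟨-, -, h | h⟩
          · exact huu w h
          · exact absurd (huu x h.2).symm hux
      · rintro u ⟨-, -, h | h⟩
        · exact hT.root_no_pred u h
        · exact hT.root_no_pred x h.2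
    · refine hk.trans (numLeaves_le_of_isTreeLeaf_imp ?_)
      rintro v ⟨-, hv⟩
      refine ⟨?_, ?_⟩
      · rintro rfl
        obtain ⟨u, hu, -⟩ := hT.unique_pred y trivial hys
        exact hv y (hdy u (hT.subgraph hu) ▸ hu)
      · rintro u ⟨-, -, h | h⟩
        · exact hv u h
        · exact hv x h.1
end

section
/- Let D be an acyclic digraph with exactly one vertex s of in-degree zero, and let R ⊆ V(D) be a set of vertices such that every vertex of D other than s has an in-neighbor in R. Then D has an out-branching T whose set of leaves contains V(D) ∖ R. -/
/-- If every vertex of an acyclic digraph `D` with a single source `s`, other than `s`,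
has an in-neighbour in `R`, then `D` has an out-branching whose set of leaves contains
`V(D) ∖ R`. -/
theorem bidominating_set_gives_out_branching
    {V : Type*} [Fintype V] (D : V → V → Prop)
    (hacyc : ∀ w : V, ¬ Relation.TransGen D w w)
    (s : V) (hs : ∀ u : V, ¬ D u s) (huniq : ∀ w : V, (∀ u : V, ¬ D u w) → w = s)
    (R : Set V) (hR : ∀ v : V, v ≠ s → ∃ u ∈ R, D u v) :
    ∃ (r : V) (T : V → V → Prop), IsOutBranching D T r ∧
      ∀ v : V, v ∉ R → IsTreeLeaf T Set.univ v := by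
  have : Std.Irrefl (Relation.TransGen D) := ⟨hacyc⟩
  have wf : WellFounded (Relation.TransGen D) := Finite.wellFounded_of_trans_of_irrefl _
  choose! p hpR hpD using hR
  refine ⟨s, fun u v => v ≠ s ∧ u = p v, ⟨?_, fun _ _ _ => trivial, fun _ _ _ => trivial,
    trivial, ?_, fun v _ hv => ⟨p v, ⟨hv, rfl⟩, fun _ h => h.2⟩, fun _ h => h.1 rfl⟩, ?_⟩
  · rintro a b ⟨hb, rfl⟩
    exact hpD b hb
  · intro v _
    induction v using wf.induction with
    | _ v ih =>
      by_cases hv : v = s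
      · rw [hv]
      · exact (ih (p v) (.single (hpD v hv)) trivial).tail ⟨hv, rfl⟩
  · rintro v hv
    refine ⟨trivial, ?_⟩
    rintro u ⟨hu, rfl⟩
    exact hv (hpR u hu)
end

section
/- Let D be an acyclic digraph on n vertices with exactly one vertex s of in-degree zero, such that every vertex of D of in-degree 1 other than s has s as its unique in-neighbor. If D has no out-branching with at least k leaves, then n < 6.6·(k+2). -/
/-- A finite family of sets, each with at least two elements and contained in `W`, has a
transversal `S` with `4 |S| ≤ 2 |W| + |E|`, where `E` is the index set of the family. -/
theorem exists_hitting_set {ι V : Type*} [DecidableEq ι] [DecidableEq V] (f : ι → Finset V)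
    (E : Finset ι) (W : Finset V) (hf : ∀ e ∈ E, f e ⊆ W ∧ 2 ≤ (f e).card) :
    ∃ S : Finset V, (∀ e ∈ E, ∃ x ∈ f e, x ∈ S) ∧ 4 * S.card ≤ 2 * W.card + E.card := by
  induction E using Finset.strongInduction generalizing W with
  | H E ih =>
    rcases E.eq_empty_or_nonempty with rfl | ⟨e, he⟩
    · exact ⟨∅, by simp, by simp⟩
    by_cases hx : ∃ x ∈ W, ∃ e₁ ∈ E, ∃ e₂ ∈ E, e₁ ≠ e₂ ∧ x ∈ f e₁ ∧ x ∈ f e₂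
    · obtain ⟨x, hxW, e₁, h₁, e₂, h₂, hne, hx₁, hx₂⟩ := hx
      have hsub : E.filter (x ∉ f ·) ⊆ (E.erase e₁).erase e₂ := by
        intro a ha
        simp only [Finset.mem_filter] at ha
        simp only [Finset.mem_erase]
        exact ⟨fun h => ha.2 (h ▸ hx₂), fun h => ha.2 (h ▸ hx₁), ha.1⟩
      have hcard := Finset.card_le_card hsub
      have hE₁ := Finset.card_erase_add_one h₁
      have hE₂ := Finset.card_erase_add_one (Finset.mem_erase.2 ⟨hne.symm, h₂⟩)
      have hW := Finset.card_erase_add_one hxW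
      obtain ⟨S, hS, hc⟩ := ih (E.filter (x ∉ f ·))
        (Finset.filter_ssubset.2 ⟨e₁, h₁, by simpa using hx₁⟩) (W.erase x) (by
          intro a ha
          simp only [Finset.mem_filter] at ha
          exact ⟨Finset.subset_erase.2 ⟨(hf a ha.1).1, ha.2⟩, (hf a ha.1).2⟩)
      refine ⟨insert x S, fun a ha => ?_, ?_⟩
      · by_cases hxa : x ∈ f a
        · exact ⟨x, hxa, Finset.mem_insert_self x S⟩
        · obtain ⟨y, hy, hyS⟩ := hS a (Finset.mem_filter.2 ⟨ha, hxa⟩)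
          exact ⟨y, hy, Finset.mem_insert_of_mem hyS⟩
      · have := Finset.card_insert_le x S
        omega
    · obtain ⟨x, hx₁, y, hy₁, hxy⟩ := Finset.one_lt_card.1 (hf e he).2
      have hxW := (hf e he).1 hx₁
      have hyW := (hf e he).1 hy₁
      have hE := Finset.card_erase_add_one he
      have hW₁ := Finset.card_erase_add_one hxW
      have hW₂ := Finset.card_erase_add_one (Finset.mem_erase.2 ⟨hxy.symm, hyW⟩)
      obtain ⟨S, hS, hc⟩ := ih (E.erase e) (Finset.erase_ssubset he) ((W.erase x).erase y) (by
        intro a ha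
        obtain ⟨hae, haE⟩ := Finset.mem_erase.1 ha
        refine ⟨Finset.subset_erase.2 ⟨Finset.subset_erase.2 ⟨(hf a haE).1, fun h => ?_⟩,
          fun h => ?_⟩, (hf a haE).2⟩
        · exact hx ⟨x, hxW, a, haE, e, he, hae, h, hx₁⟩
        · exact hx ⟨y, hyW, a, haE, e, he, hae, h, hy₁⟩)
      refine ⟨insert x S, fun a ha => ?_, ?_⟩
      · by_cases hae : a = e
        · exact ⟨x, hae ▸ hx₁, Finset.mem_insert_self x S⟩
        · obtain ⟨z, hz, hzS⟩ := hS a (Finset.mem_erase.2 ⟨hae, ha⟩)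
          exact ⟨z, hz, Finset.mem_insert_of_mem hzS⟩
      · have := Finset.card_insert_le x S
        omega

/-- In a finite acyclic digraph with unique source `s`, choosing an in-neighbour `p v` of every
vertex `v ≠ s` yields an out-branching rooted at `s`. -/
theorem isOutBranching_of_pred {V : Type*} [Finite V] {D : V → V → Prop}
    (hacyc : ∀ w : V, ¬ Relation.TransGen D w w) {s : V} {p : V → V}
    (hp : ∀ v, v ≠ s → D (p v) v) : IsOutBranching D (fun a b => b ≠ s ∧ a = p b) s where
  subgraph := by
    rintro a b ⟨hb, rfl⟩
    exact hp b hb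
  mem_left _ _ _ := Set.mem_univ _
  mem_right _ _ _ := Set.mem_univ _
  root_mem := Set.mem_univ _
  reach v _ := by
    have : Std.Irrefl (Relation.TransGen D) := ⟨hacyc⟩
    have hwf : WellFounded (Relation.TransGen D) := Finite.wellFounded_of_trans_of_irrefl _
    induction v using hwf.induction with
    | _ v ih =>
      by_cases hv : v = s
      · exact hv ▸ Relation.ReflTransGen.refl
      · exact (ih (p v) (.single (hp v hv)) (Set.mem_univ _)).tail ⟨hv, rfl⟩
  unique_pred v _ hv := ⟨p v, ⟨hv, rfl⟩, fun _ h => h.2⟩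
  root_no_pred _ h := h.1 rfl

/-- If an acyclic digraph `D` on `n` vertices with a single source `s`, in which every
vertex of in-degree `1` other than `s` has `s` as its unique in-neighbour, has no
out-branching with at least `k` leaves, then `n < 6.6 (k + 2)`. -/
theorem linear_kernel_bound
    {V : Type*} [Fintype V] (D : V → V → Prop)
    (hacyc : ∀ w : V, ¬ Relation.TransGen D w w)
    (s : V) (hs : ∀ u : V, ¬ D u s) (huniq : ∀ w : V, (∀ u : V, ¬ D u w) → w = s)
    (hdeg1 : ∀ v : V, v ≠ s → {a : V | D a v}.ncard = 1 → ∀ u : V, D u v → u = s)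
    (k : ℕ)
    (hno : ¬ ∃ (r : V) (T : V → V → Prop),
      IsOutBranching D T r ∧ k ≤ numLeaves T Set.univ) :
    (Fintype.card V : ℝ) < 6.6 * ((k : ℝ) + 2) := by
  classical
  let f : V → Finset V := fun v => Finset.univ.filter (D · v)
  have htwo : ∀ v, v ≠ s → ¬ D s v → 2 ≤ (f v).card := by
    intro v hv hsv
    obtain ⟨u, hu⟩ : ∃ u, D u v := by
      by_contra! h
      exact hv (huniq v h)
    have hpos : 0 < (f v).card := Finset.card_pos.2 ⟨u, by simpa [f] using hu⟩
    have hone : (f v).card ≠ 1 := by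
      intro h
      have hset : {a : V | D a v} = (f v : Set V) := by ext; simp [f]
      exact hsv (hdeg1 v hv (by rw [hset, Set.ncard_coe_finset, h]) u hu ▸ hu)
    omega
  obtain ⟨S, hS, hcard⟩ := exists_hitting_set f
    (Finset.univ.filter fun v => v ≠ s ∧ ¬ D s v) Finset.univ (by
      intro v hv
      simp only [Finset.mem_filter, Finset.mem_univ, true_and] at hv
      exact ⟨Finset.subset_univ _, htwo v hv.1 hv.2⟩)
  have hpred : ∀ v, ∃ u, v ≠ s → D u v ∧ u ∈ insert s S := by
    intro v
    by_cases hv : v ≠ s ∧ ¬ D s v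
    · obtain ⟨u, hu, huS⟩ := hS v (by simpa using hv)
      exact ⟨u, fun _ => ⟨by simpa [f] using hu, Finset.mem_insert_of_mem huS⟩⟩
    · exact ⟨s, fun h => ⟨by tauto, Finset.mem_insert_self s S⟩⟩
  choose p hp using hpred
  have hT := isOutBranching_of_pred hacyc (p := p) fun v hv => (hp v hv).1
  have hleaves : (insert s S)ᶜ.card ≤ numLeaves (fun a b => b ≠ s ∧ a = p b) Set.univ := by
    rw [numLeaves, ← Set.ncard_coe_finset]
    refine Set.ncard_le_ncard (fun v hv => ⟨Set.mem_univ v, ?_⟩) (Set.toFinite _)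
    rintro u ⟨hu, rfl⟩
    simp only [Finset.mem_coe, Finset.mem_compl] at hv
    exact hv (hp u hu).2
  have hlt : numLeaves (fun a b => b ≠ s ∧ a = p b) Set.univ < k := by
    by_contra! h
    exact hno ⟨s, _, hT, h⟩
  have hE := Finset.card_le_univ (Finset.univ.filter fun v => v ≠ s ∧ ¬ D s v)
  have hins := Finset.card_insert_le s S
  rw [Finset.card_compl] at hleaves
  rw [Finset.card_univ] at hcard
  have hn : Fintype.card V < 4 * k + 4 := by omega
  have hn' : (Fintype.card V : ℝ) < 4 * k + 4 := by exact_mod_cast hn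
  have hk : (0 : ℝ) ≤ k := Nat.cast_nonneg k
  linarith
end

section
/- Let D be an acyclic digraph on n vertices with exactly one vertex s of in-degree zero, such that every vertex of D of in-degree 1 other than s has s as its unique in-neighbor. Then D has an out-branching with at least n·(1 − ln 2)/2 − 2 leaves. -/
/-- A finite multigraph on `U`, with edges `{a i, b i}` for `i ∈ E` (only those with both ends
in `U` count), has an independent set `I` with `2 |U| ≤ 3 |I| + |E|`. -/
theorem exists_independent_two_mul_card_le {V ι : Type*} [DecidableEq V] [DecidableEq ι]
    (a b : ι → V) (U : Finset V) (E : Finset ι) (hab : ∀ i ∈ E, a i ≠ b i) :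
    ∃ I ⊆ U, (∀ i ∈ E, a i ∈ I → b i ∉ I) ∧ 2 * U.card ≤ 3 * I.card + E.card := by
  induction U using Finset.strongInduction generalizing E with
  | H U ih =>
    obtain rfl | ⟨x, hx⟩ := U.eq_empty_or_nonempty
    · exact ⟨∅, by simp⟩
    have hUpos : 0 < U.card := Finset.card_pos.2 ⟨x, hx⟩
    by_cases hdeg : ∃ x ∈ U, 2 ≤ {i ∈ E | a i = x ∨ b i = x}.card
    · obtain ⟨x, hx, h2⟩ := hdeg
      obtain ⟨I, hIU, hI, hc⟩ := ih (U.erase x) (Finset.erase_ssubset hx)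
        {i ∈ E | ¬(a i = x ∨ b i = x)} (fun i hi => hab i (Finset.mem_filter.1 hi).1)
      have hxI : x ∉ I := fun h => Finset.notMem_erase x U (hIU h)
      refine ⟨I, hIU.trans (Finset.erase_subset _ _), fun i hi hai hbi => ?_, ?_⟩
      · refine hI i (Finset.mem_filter.2 ⟨hi, ?_⟩) hai hbi
        rintro (rfl | rfl) <;> contradiction
      · have := Finset.card_filter_add_card_filter_not (s := E) (fun i => a i = x ∨ b i = x)
        have := Finset.card_erase_of_mem hx
        omega
    · push Not at hdeg
      have hlt := hdeg x hx
      obtain hF | ⟨j, hF⟩ : {i ∈ E | a i = x ∨ b i = x} = ∅ ∨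
          ∃ j, {i ∈ E | a i = x ∨ b i = x} = {j} := by
        rw [← Finset.card_eq_zero, ← Finset.card_eq_one]
        omega
      · obtain ⟨I, hIU, hI, hc⟩ := ih (U.erase x) (Finset.erase_ssubset hx) E hab
        have hxI : x ∉ I := fun h => Finset.notMem_erase x U (hIU h)
        refine ⟨insert x I, Finset.insert_subset hx (hIU.trans (Finset.erase_subset _ _)),
          fun i hi hai hbi => ?_, ?_⟩
        · have hix := Finset.filter_eq_empty_iff.1 hF hi
          push Not at hix
          exact hI i hi (Finset.mem_of_mem_insert_of_ne hai hix.1)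
            (Finset.mem_of_mem_insert_of_ne hbi hix.2)
        · have := Finset.card_insert_of_notMem hxI
          have := Finset.card_erase_of_mem hx
          omega
      · have hj : j ∈ E ∧ (a j = x ∨ b j = x) :=
          Finset.mem_filter.1 (hF ▸ Finset.mem_singleton_self j)
        obtain ⟨I, hIU, hI, hc⟩ := ih (U \ {a j, b j})
          (Finset.ssubset_iff_of_subset Finset.sdiff_subset |>.2 ⟨x, hx, by grind⟩)
          (E.erase j) (fun i hi => hab i (Finset.mem_of_mem_erase hi))
        have haI : a j ∉ I := fun h => by simpa using hIU h
        have hbI : b j ∉ I := fun h => by simpa using hIU h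
        have hxI : x ∉ I := by grind
        refine ⟨insert x I, Finset.insert_subset hx (hIU.trans Finset.sdiff_subset),
          fun i hi hai hbi => ?_, ?_⟩
        · by_cases hij : i = j
          · subst hij
            exact hab i hi (((Finset.mem_insert.1 hai).resolve_right haI).trans
              ((Finset.mem_insert.1 hbi).resolve_right hbI).symm)
          · have hix : ¬(a i = x ∨ b i = x) := fun h =>
              hij (Finset.mem_singleton.1 (hF ▸ Finset.mem_filter.2 ⟨hi, h⟩))
            push Not at hix
            exact hI i (Finset.mem_erase.2 ⟨hij, hi⟩) (Finset.mem_of_mem_insert_of_ne hai hix.1)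
              (Finset.mem_of_mem_insert_of_ne hbi hix.2)
        · have := Finset.card_insert_of_notMem hxI
          have := Finset.le_card_sdiff {a j, b j} U
          have := Finset.card_le_two (a := a j) (b := b j)
          have := Finset.card_erase_add_one hj.1
          omega

/-- In a finite acyclic digraph, choosing an in-neighbour of every vertex other than the source
`s` gives an out-branching rooted at `s`. -/
theorem isOutBranching_of_parent {V : Type*} [Finite V] {D : V → V → Prop}
    (hacyc : ∀ w : V, ¬ Relation.TransGen D w w) {s : V} {p : V → V}
    (hp : ∀ v, v ≠ s → D (p v) v) :
    IsOutBranching D (fun u v => v ≠ s ∧ p v = u) s where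
  subgraph := by
    rintro _ v ⟨hv, rfl⟩
    exact hp v hv
  mem_left _ _ _ := Set.mem_univ _
  mem_right _ _ _ := Set.mem_univ _
  root_mem := Set.mem_univ _
  reach := by
    have : Std.Irrefl (Relation.TransGen D) := ⟨hacyc⟩
    have hwf : WellFounded (Relation.TransGen D) :=
      Finite.wellFounded_of_trans_of_irrefl _
    intro v _
    induction v using hwf.induction with
    | _ v ih =>
      by_cases hv : v = s
      · rw [hv]
      · exact (ih (p v) (.single (hp v hv)) (Set.mem_univ _)).tail ⟨hv, rfl⟩
  unique_pred v _ hv := ⟨p v, ⟨hv, rfl⟩, fun _ h => h.2.symm⟩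
  root_no_pred _ h := h.1 rfl

/-- An acyclic digraph `D` on `n` vertices with a single source `s`, in which every vertex
of in-degree `1` other than `s` has `s` as its unique in-neighbour, has an out-branching
with at least `n (1 − ln 2) / 2 − 2` leaves. -/
theorem reduced_digraph_many_leaves
    {V : Type*} [Fintype V] (D : V → V → Prop)
    (hacyc : ∀ w : V, ¬ Relation.TransGen D w w)
    (s : V) (hs : ∀ u : V, ¬ D u s) (huniq : ∀ w : V, (∀ u : V, ¬ D u w) → w = s)
    (hdeg1 : ∀ v : V, v ≠ s → {a : V | D a v}.ncard = 1 → ∀ u : V, D u v → u = s) :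
    ∃ (r : V) (T : V → V → Prop), IsOutBranching D T r ∧
      (Fintype.card V : ℝ) * (1 - Real.log 2) / 2 - 2 ≤ (numLeaves T Set.univ : ℝ) := by
  classical
  have hpair : ∀ v, ∃ a b : V, v ≠ s → ¬ D s v → a ≠ b ∧ D a v ∧ D b v := by
    intro v
    by_cases hv : v = s
    · exact ⟨s, s, fun h => absurd hv h⟩
    by_cases hsv : D s v
    · exact ⟨s, s, fun _ h => absurd hsv h⟩
    obtain ⟨a, ha⟩ : ∃ a, D a v := by
      by_contra! h
      exact hv (huniq v h)
    have hne : {a : V | D a v}.ncard ≠ 1 := fun h => hsv (hdeg1 v hv h a ha ▸ ha)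
    have hpos : 0 < {a : V | D a v}.ncard := (Set.ncard_pos).2 ⟨a, ha⟩
    obtain ⟨b, hb, hba⟩ := Set.exists_ne_of_one_lt_ncard (s := {a : V | D a v}) (by omega) a
    exact ⟨a, b, fun _ _ => ⟨hba.symm, ha, hb⟩⟩
  choose a b hab using hpair
  obtain ⟨I, hIU, hI, hc⟩ := exists_independent_two_mul_card_le a b (Finset.univ.erase s)
    {v ∈ Finset.univ.erase s | ¬ D s v} (by
      intro v hv
      rw [Finset.mem_filter] at hv
      exact (hab v (Finset.ne_of_mem_erase hv.1) hv.2).1)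
  have hsI : s ∉ I := fun h => Finset.notMem_erase s _ (hIU h)
  have hparent : ∀ v, ∃ u, v ≠ s → D u v ∧ u ∉ I := by
    intro v
    by_cases hv : v = s
    · exact ⟨s, fun h => absurd hv h⟩
    by_cases hsv : D s v
    · exact ⟨s, fun _ => ⟨hsv, hsI⟩⟩
    obtain ⟨-, ha, hb⟩ := hab v hv hsv
    by_cases haI : a v ∈ I
    · exact ⟨b v, fun _ => ⟨hb, hI v (by simp [hv, hsv]) haI⟩⟩
    · exact ⟨a v, fun _ => ⟨ha, haI⟩⟩
  choose p hp using hparent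
  refine ⟨s, _, isOutBranching_of_parent hacyc (fun v hv => (hp v hv).1), ?_⟩
  have hleaves : I.card ≤ numLeaves (fun u v => v ≠ s ∧ p v = u) Set.univ := by
    rw [numLeaves, ← Set.ncard_coe_finset]
    refine Set.ncard_le_ncard (fun u hu => ⟨Set.mem_univ u, ?_⟩)
    rintro v ⟨hv, rfl⟩
    exact (hp v hv).2 hu
  have hcard := Finset.card_filter_le (Finset.univ.erase s) (fun v => ¬ D s v)
  have hU := Finset.card_erase_add_one (Finset.mem_univ s)
  rw [Finset.card_univ] at hU
  have hn : Fintype.card V ≤ 3 * numLeaves (fun u v => v ≠ s ∧ p v = u) Set.univ + 1 := by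
    omega
  have hn' : (Fintype.card V : ℝ) ≤
      3 * (numLeaves (fun u v => v ≠ s ∧ p v = u) Set.univ : ℝ) + 1 := by
    exact_mod_cast hn
  have hlog := Real.log_two_gt_d9
  nlinarith [mul_nonneg (Nat.cast_nonneg (α := ℝ) (Fintype.card V))
    (by linarith : (0 : ℝ) ≤ Real.log 2 - 1 / 2)]
end
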